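/- Let ⟨X, Ω⟩ be an MV-topological space and Y ⊆ X a crisp subset whose characteristic function χ_Y is closed (i.e. (χ_Y)* ∈ Ω). If ⟨X, Ω⟩ is compact, then the subspace ⟨Y, Ω_Y⟩ (with Ω_Y the restrictions to Y of the members of Ω) is compact: for every family {o_i}_{i∈I} ⊆ Ω with ⋁_{i∈I} o_i ≥ χ_Y there is a finite list o_1, …, o_n from the family with (o_1 ⊕ ⋯ ⊕ o_n)(y) = 1 for all y ∈ Y. Likewise, if ⟨X, Ω⟩ is strongly compact then ⟨Y, Ω_Y⟩ is strongly compact. -/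

import Mathlib

open Set unitInterval

noncomputable section

instance : Fact ((0:ℝ) ≤ 1) := ⟨zero_le_one⟩

noncomputable instance : CompleteLattice unitInterval := Set.Icc.completeLattice

namespace MVStone

/-- Truncated sum on [0,1]. -/
def oplus (a b : unitInterval) : unitInterval :=
  ⟨min (a.1 + b.1) 1, ⟨le_min (add_nonneg a.2.1 b.2.1) zero_le_one, min_le_right _ _⟩⟩

/-- Truncated product (Łukasiewicz t-norm) on [0,1]. -/
def odot (a b : unitInterval) : unitInterval :=
  ⟨max (a.1 + b.1 - 1) 0, ⟨le_max_right _ _, max_le (by have := a.2.2; have := b.2.2; linarith) zero_le_one⟩⟩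

/-- Truncated difference on [0,1]. -/
def ominus (a b : unitInterval) : unitInterval :=
  ⟨max (a.1 - b.1) 0, ⟨le_max_right _ _, max_le (by have := a.2.2; have := b.2.1; linarith) zero_le_one⟩⟩

variable {X : Type*}

def pOplus (α β : X → unitInterval) : X → unitInterval := fun x => oplus (α x) (β x)
def pOdot (α β : X → unitInterval) : X → unitInterval := fun x => odot (α x) (β x)
def pStar (α : X → unitInterval) : X → unitInterval := fun x => σ (α x)
def pMin (α β : X → unitInterval) : X → unitInterval := fun x => min (α x) (β x)
def pMax (α β : X → unitInterval) : X → unitInterval := fun x => max (α x) (β x)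

/-- Pointwise supremum of a family of fuzzy subsets. -/
def pSup (Γ : Set (X → unitInterval)) : X → unitInterval := fun x => ⨆ α ∈ Γ, α x
/-- Pointwise infimum of a family of fuzzy subsets. -/
def pInf (Γ : Set (X → unitInterval)) : X → unitInterval := fun x => ⨅ α ∈ Γ, α x

structure IsMVTopology (Ω : Set (X → unitInterval)) : Prop where
  zero_mem : (fun _ => (0 : unitInterval)) ∈ Ω
  one_mem : (fun _ => (1 : unitInterval)) ∈ Ω
  sSup_mem : ∀ Γ ⊆ Ω, pSup Γ ∈ Ω
  oplus_mem : ∀ α ∈ Ω, ∀ β ∈ Ω, pOplus α β ∈ Ω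
  odot_mem : ∀ α ∈ Ω, ∀ β ∈ Ω, pOdot α β ∈ Ω
  min_mem : ∀ α ∈ Ω, ∀ β ∈ Ω, pMin α β ∈ Ω

def IsCovering (Γ : Set (X → unitInterval)) : Prop := pSup Γ = fun _ => 1

/-- `⊕`-sum of a finite list of fuzzy subsets. -/
def sumList (l : List (X → unitInterval)) : X → unitInterval :=
  l.foldr pOplus (fun _ => 0)

/-- Compactness: every open covering contains a finite list whose `⊕`-sum is `1`. -/
def MVCompact (Ω : Set (X → unitInterval)) : Prop :=
  ∀ Γ ⊆ Ω, IsCovering Γ →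
    ∃ l : List (X → unitInterval), (∀ o ∈ l, o ∈ Γ) ∧ sumList l = fun _ => 1

/-- Strong compactness: every open covering contains a finite subcovering. -/
def MVStronglyCompact (Ω : Set (X → unitInterval)) : Prop :=
  ∀ Γ ⊆ Ω, IsCovering Γ → ∃ F ⊆ Γ, F.Finite ∧ IsCovering F

def MVHausdorff (Ω : Set (X → unitInterval)) : Prop :=
  ∀ x y : X, x ≠ y → ∃ ox ∈ Ω, ∃ oy ∈ Ω,
    ox x = 1 ∧ oy y = 1 ∧ pMin ox oy = fun _ => 0

def IsBase (Ω Θ : Set (X → unitInterval)) : Prop :=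
  Θ ⊆ Ω ∧ ∀ o ∈ Ω, ∃ G ⊆ Θ, o = pSup G

def MVClopen (Ω : Set (X → unitInterval)) (α : X → unitInterval) : Prop :=
  α ∈ Ω ∧ pStar α ∈ Ω

def Clop (Ω : Set (X → unitInterval)) : Set (X → unitInterval) := {α | MVClopen Ω α}

def IsStoneMVSpace (Ω : Set (X → unitInterval)) : Prop :=
  IsMVTopology Ω ∧ MVCompact Ω ∧ MVHausdorff Ω ∧
    ∃ Θ, IsBase Ω Θ ∧ ∀ θ ∈ Θ, MVClopen Ω θ

/-- Ideal of a set `A` of fuzzy subsets closed under `⊕` (w.r.t. the pointwise order). -/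
def IsIdealOf (A M : Set (X → unitInterval)) : Prop :=
  M ⊆ A ∧ (fun _ => (0 : unitInterval)) ∈ M ∧ (∀ a ∈ M, ∀ b ∈ M, pOplus a b ∈ M) ∧
    ∀ a ∈ A, ∀ b ∈ M, a ≤ b → a ∈ M

def IsMaximalIdealOf (A M : Set (X → unitInterval)) : Prop :=
  IsIdealOf A M ∧ M ≠ A ∧ ∀ N, IsIdealOf A N → N ≠ A → M ⊆ N → M = N


theorem oplus_zero_left (a : unitInterval) : oplus 0 a = a := by
  apply Subtype.ext
  simp [oplus, a.2.2]

theorem sumList_cons (a : X → unitInterval) (l : List (X → unitInterval)) (x : X) :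
    sumList (a :: l) x = oplus (a x) (sumList l x) := rfl

open Classical in
/-- Dropping members that vanish at `x` does not change the `⊕`-sum at `x`. -/
theorem sumList_filter_apply (p : (X → unitInterval) → Prop) (x : X)
    (l : List (X → unitInterval)) (h : ∀ o ∈ l, ¬ p o → o x = 0) :
    sumList (l.filter fun o => p o) x = sumList l x := by
  induction l with
  | nil => rfl
  | cons a l ih =>
    have ih' := ih fun o ho => h o (List.mem_cons_of_mem _ ho)
    by_cases ha : p a
    · simp [ha, sumList_cons, ih']
    · simp [ha, sumList_cons, ih', h a List.mem_cons_self ha, oplus_zero_left]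

theorem le_pSup {Γ : Set (X → unitInterval)} {o : X → unitInterval} (ho : o ∈ Γ) (x : X) :
    o x ≤ pSup Γ x :=
  le_iSup₂ (f := fun (α : X → unitInterval) (_ : α ∈ Γ) => α x) o ho

theorem pSup_apply_le {Γ : Set (X → unitInterval)} {x : X} {a : unitInterval}
    (h : ∀ o ∈ Γ, o x ≤ a) : pSup Γ x ≤ a :=
  iSup₂_le (f := fun (α : X → unitInterval) (_ : α ∈ Γ) => α x) h

theorem pStar_indicator_of_mem {Y : Set X} {y : X} (hy : y ∈ Y) :
    pStar (Y.indicator fun _ => (1 : unitInterval)) y = 0 := by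
  simp [pStar, hy]

theorem pStar_indicator_of_notMem {Y : Set X} {y : X} (hy : y ∉ Y) :
    pStar (Y.indicator fun _ => (1 : unitInterval)) y = 1 := by
  simp [pStar, hy]

theorem isCovering_insert_pStar_indicator {Y : Set X} {Γ : Set (X → unitInterval)}
    (h : Y.indicator (fun _ => (1 : unitInterval)) ≤ pSup Γ) :
    IsCovering (insert (pStar (Y.indicator fun _ => (1 : unitInterval))) Γ) := by
  funext x
  apply le_antisymm le_one'
  by_cases hx : x ∈ Y
  · have hx1 : (1 : unitInterval) ≤ pSup Γ x := by simpa [hx] using h x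
    exact hx1.trans (pSup_apply_le fun o ho => le_pSup (Set.mem_insert_of_mem _ ho) x)
  · refine (pStar_indicator_of_notMem hx).ge.trans ?_
    exact le_pSup (Set.mem_insert _ _) x

theorem stmt12 {X : Type*} (Ω : Set (X → unitInterval)) (hΩ : IsMVTopology Ω) (Y : Set X)
    (hcl : pStar (Y.indicator fun _ => (1 : unitInterval)) ∈ Ω) :
    (MVCompact Ω → ∀ Γ ⊆ Ω, Y.indicator (fun _ => (1 : unitInterval)) ≤ pSup Γ →
      ∃ l : List (X → unitInterval), (∀ o ∈ l, o ∈ Γ) ∧ ∀ y ∈ Y, sumList l y = 1) ∧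
    (MVStronglyCompact Ω → ∀ Γ ⊆ Ω, Y.indicator (fun _ => (1 : unitInterval)) ≤ pSup Γ →
      ∃ F ⊆ Γ, F.Finite ∧ ∀ y ∈ Y, pSup F y = 1) := by
  classical
  have hsub : ∀ Γ ⊆ Ω, insert (pStar (Y.indicator fun _ => (1 : unitInterval))) Γ ⊆ Ω :=
    fun Γ hΓ => Set.insert_subset hcl hΓ
  refine ⟨fun hc Γ hΓ hY => ?_, fun hc Γ hΓ hY => ?_⟩
  · obtain ⟨l, hl, hsum⟩ := hc _ (hsub Γ hΓ) (isCovering_insert_pStar_indicator hY)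
    refine ⟨l.filter fun o => o ∈ Γ, fun o ho => by simpa using (List.mem_filter.1 ho).2,
      fun y hy => ?_⟩
    rw [← congrFun hsum y]
    convert sumList_filter_apply (· ∈ Γ) y l fun o ho hoΓ => ?_
    rw [(hl o ho).resolve_right hoΓ, pStar_indicator_of_mem hy]
  · obtain ⟨F, hF, hfin, hcov⟩ := hc _ (hsub Γ hΓ) (isCovering_insert_pStar_indicator hY)
    refine ⟨F ∩ Γ, Set.inter_subset_right, hfin.inter_of_left Γ, fun y hy => ?_⟩
    apply le_antisymm le_one'
    rw [← congrFun hcov y]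
    refine pSup_apply_le fun o ho => ?_
    by_cases hoΓ : o ∈ Γ
    · exact le_pSup (Set.mem_inter ho hoΓ) y
    · rw [(hF ho).resolve_right hoΓ, pStar_indicator_of_mem hy]
      exact nonneg'

end MVStone
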